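/- Let X be a real Banach space, let (x_j)_{j∈ℕ} be a sequence in X with ‖x_j‖ = 1 for all j, let 1 ≤ p ≤ ∞, and let ℓ^p(X*) denote the ℓ^p-sum of countably many copies of the continuous dual X*. Let Λ₀ ⊆ ℕ be an infinite set, let m ≥ 1, let y₁, …, y_m ∈ ℓ^p(X*), let n₀ ∈ ℕ, let η > 0, and let M ≥ 1. Then there exists a finite set F ⊆ Λ₀ with |F| = 2M such that for every choice of signs ε_k ∈ {−1, +1} (k ∈ F) satisfying ∑_{k∈F} ε_k = 0, one has |∑_{k∈F} ε_k · (y_ℓ(n₀))(x_k)| ≤ η for all 1 ≤ ℓ ≤ m. -/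

import Mathlib

open scoped ENNReal

/-- A bounded sequence in a proper metric space has, along any infinite index set, arbitrarily many
terms clustered near a single point. -/
lemma exists_finset_card_eq_forall_dist_lt {E : Type*} [PseudoMetricSpace E] [ProperSpace E]
    {v : ℕ → E} (hv : Bornology.IsBounded (Set.range v)) {Λ : Set ℕ} (hΛ : Λ.Infinite)
    (N : ℕ) {δ : ℝ} (hδ : 0 < δ) :
    ∃ (a : E) (F : Finset ℕ), ↑F ⊆ Λ ∧ F.card = N ∧ ∀ k ∈ F, dist (v k) a < δ := by
  let e := hΛ.natEmbedding
  obtain ⟨a, -, φ, hφ, hlim⟩ :=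
    tendsto_subseq_of_bounded hv (x := fun n => v (e n)) fun n => Set.mem_range_self _
  obtain ⟨K, hK⟩ := Metric.tendsto_atTop.1 hlim δ hδ
  have hinj : Function.Injective fun i : ℕ => (e (φ (K + i)) : ℕ) := fun i j hij =>
    Nat.add_left_cancel (hφ.injective (e.injective (Subtype.ext hij)))
  refine ⟨a, (Finset.range N).map ⟨_, hinj⟩, ?_, by simp, ?_⟩
  · intro k hk
    obtain ⟨i, -, rfl⟩ := Finset.mem_map.1 (Finset.mem_coe.1 hk)
    exact (e (φ (K + i))).2
  · intro k hk
    obtain ⟨i, -, rfl⟩ := Finset.mem_map.1 hk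
    exact hK (K + i) (Nat.le_add_right K i)

/-- A balanced signed sum of reals within `δ` of a common value is at most `#F * δ`. -/
lemma abs_sum_sign_mul_le_card_mul {ι : Type*} {F : Finset ι} {ε f : ι → ℝ} {a δ : ℝ}
    (hε : ∀ k ∈ F, ε k = 1 ∨ ε k = -1) (hsum : ∑ k ∈ F, ε k = 0)
    (hf : ∀ k ∈ F, |f k - a| ≤ δ) : |∑ k ∈ F, ε k * f k| ≤ F.card * δ := by
  have hcenter : ∑ k ∈ F, ε k * f k = ∑ k ∈ F, ε k * (f k - a) := by
    simp [mul_sub, Finset.sum_sub_distrib, ← Finset.sum_mul, hsum]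
  rw [hcenter, ← nsmul_eq_mul]
  refine (Finset.abs_sum_le_sum_abs _ _).trans (Finset.sum_le_card_nsmul _ _ _ fun k hk => ?_)
  rcases hε k hk with h | h <;> simpa only [h, one_mul, neg_mul, abs_neg] using hf k hk

/-- **Two-parameter subspace annihilation lemma (Lemma 5.1).**  Let `X` be a real Banach space,
`(x j)` a normalized sequence in `X`, `1 ≤ p ≤ ∞`, and consider `ℓ^p(X*)`, the `ℓ^p`-sum of
countably many copies of the dual `X*`.  Given an infinite `Λ₀ ⊆ ℕ`, `m ≥ 1`,
`y₁, …, y_m ∈ ℓ^p(X*)`, `n₀ ∈ ℕ`, `η > 0` and `M ≥ 1`, there is a finite set `F ⊆ Λ₀` with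
`|F| = 2M` such that for every choice of signs `ε k ∈ {−1, +1}` (`k ∈ F`) with
`∑_{k ∈ F} ε k = 0` one has `|∑_{k ∈ F} ε k • (y_ℓ(n₀))(x k)| ≤ η` for all `ℓ`. -/
theorem two_parameter_subspace_annihilation
    (X : Type*) [NormedAddCommGroup X] [NormedSpace ℝ X] [CompleteSpace X]
    (x : ℕ → X) (hx : ∀ j, ‖x j‖ = 1)
    (p : ℝ≥0∞) [Fact (1 ≤ p)]
    (Λ₀ : Set ℕ) (hΛ₀ : Λ₀.Infinite)
    (m : ℕ) (hm : 1 ≤ m)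
    (y : Fin m → lp (fun _ : ℕ => X →L[ℝ] ℝ) p)
    (n₀ : ℕ) (η : ℝ) (hη : 0 < η) (M : ℕ) (hM : 1 ≤ M) :
    ∃ F : Finset ℕ, ↑F ⊆ Λ₀ ∧ F.card = 2 * M ∧
      ∀ ε : ℕ → ℝ, (∀ k ∈ F, ε k = 1 ∨ ε k = -1) → (∑ k ∈ F, ε k) = 0 →
        ∀ ℓ : Fin m, |∑ k ∈ F, ε k * (y ℓ n₀) (x k)| ≤ η := by
  have hbdd : Bornology.IsBounded (Set.range fun k (ℓ : Fin m) => (y ℓ n₀) (x k)) := by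
    refine Bornology.forall_isBounded_image_eval_iff.1 fun ℓ => ?_
    refine isBounded_iff_forall_norm_le.2 ⟨‖y ℓ n₀‖, ?_⟩
    rintro _ ⟨_, ⟨k, rfl⟩, rfl⟩
    simpa [hx k] using (y ℓ n₀).le_opNorm (x k)
  have hM₀ : (0 : ℝ) < (2 * M : ℕ) := by exact_mod_cast (by omega : 0 < 2 * M)
  obtain ⟨a, F, hFΛ, hFcard, hF⟩ :=
    exists_finset_card_eq_forall_dist_lt hbdd hΛ₀ (2 * M) (div_pos hη hM₀)
  refine ⟨F, hFΛ, hFcard, fun ε hε hsum ℓ => ?_⟩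
  have hclose : ∀ k ∈ F, |(y ℓ n₀) (x k) - a ℓ| ≤ η / (2 * M : ℕ) := fun k hk =>
    (dist_le_pi_dist (fun ℓ : Fin m => (y ℓ n₀) (x k)) a ℓ).trans (hF k hk).le
  have hle := abs_sum_sign_mul_le_card_mul hε hsum hclose
  rwa [hFcard, mul_div_cancel₀ _ hM₀.ne'] at hle
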